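/- Let R : ℝ⁺ → ℝ⁺ be a regularly increasing function with index 0 and let φ : ℝ⁺ → ℝ⁺ be an increasing function satisfying log φ(n) = √n · R(n) for all n. Then the Hausdorff dimension of L(φ) equals 1/2. -/

import Mathlib

open Filter Set
open scoped ENNReal

/-- The Gauss map. -/
noncomputable def gaussMap (x : ℝ) : ℝ := Int.fract (1 / x)

/-- The `n`-th partial quotient `a_n(x)` (for `n ≥ 1`) of the continued fraction
expansion of `x ∈ (0,1)`. -/
noncomputable def pq (x : ℝ) (n : ℕ) : ℕ := ⌊1 / (gaussMap^[n - 1] x)⌋₊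

/-- `L_n(x) = max_{1 ≤ i ≤ n} a_i(x) a_{i+1}(x)`. -/
noncomputable def Lmax (x : ℝ) (n : ℕ) : ℕ :=
  (Finset.Icc 1 n).sup fun i => pq x i * pq x (i + 1)

/-- The level set `L(φ)` of irrational `x ∈ (0,1)` with `L_n(x)/φ(n) → 1`. -/
def Lset (φ : ℕ → ℝ) : Set ℝ :=
  {x | x ∈ Ioo (0 : ℝ) 1 ∧ Irrational x ∧
    Tendsto (fun n => (Lmax x n : ℝ) / φ n) atTop (nhds 1)}

/-- `f` is regularly increasing with (finite) index `ρ`. -/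
def RegInc (f : ℝ → ℝ) (ρ : ℝ) : Prop :=
  ∃ c > (0 : ℝ), ∃ f' : ℝ → ℝ,
    (∀ x ∈ Ici c, 0 < f x) ∧
    (∀ x ∈ Ici c, HasDerivAt f (f' x) x) ∧
    ContinuousOn f' (Ici c) ∧
    (∀ x ∈ Ici c, 0 < f' x) ∧
    Tendsto f atTop atTop ∧
    Tendsto (fun x => x * f' x / f x) atTop (nhds ρ)

/-- `f` is regularly increasing with index `∞`. -/
def RegIncTop (f : ℝ → ℝ) : Prop :=
  ∃ c > (0 : ℝ), ∃ f' : ℝ → ℝ,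
    (∀ x ∈ Ici c, 0 < f x) ∧
    (∀ x ∈ Ici c, HasDerivAt f (f' x) x) ∧
    ContinuousOn f' (Ici c) ∧
    (∀ x ∈ Ici c, 0 < f' x) ∧
    Tendsto f atTop atTop ∧
    Tendsto (fun x => x * f' x / f x) atTop atTop

theorem gaussMap_mem {x : ℝ} (hx : x ∈ Ioo (0 : ℝ) 1 ∧ Irrational x) :
    gaussMap x ∈ Ioo (0 : ℝ) 1 ∧ Irrational (gaussMap x) := by
  have h2 : Irrational (gaussMap x) := by
    have : Irrational (1 / x) := by simpa using hx.2.inv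
    exact this.sub_intCast ⌊1 / x⌋
  exact ⟨⟨lt_of_le_of_ne (Int.fract_nonneg _) (fun h => h2 ⟨0, by simpa using h⟩),
    Int.fract_lt_one _⟩, h2⟩

theorem gaussMap_iterate_mem {x : ℝ} (hx : x ∈ Ioo (0 : ℝ) 1 ∧ Irrational x) (n : ℕ) :
    gaussMap^[n] x ∈ Ioo (0 : ℝ) 1 ∧ Irrational (gaussMap^[n] x) := by
  induction n generalizing x with
  | zero => exact hx
  | succ n ih => exact ih (gaussMap_mem hx)

theorem pq_add_two (x : ℝ) (n : ℕ) : pq x (n + 1 + 1) = pq (gaussMap x) (n + 1) := rfl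

theorem one_le_pq {x : ℝ} (hx : x ∈ Ioo (0 : ℝ) 1 ∧ Irrational x) (n : ℕ) : 1 ≤ pq x n := by
  obtain ⟨⟨h0, h1⟩, -⟩ := gaussMap_iterate_mem hx (n - 1)
  apply Nat.le_floor
  rw [le_div_iff₀ h0]
  push_cast
  linarith

theorem eq_one_div_pq_add {x : ℝ} (hx : x ∈ Ioo (0 : ℝ) 1) :
    x = 1 / (pq x 1 + gaussMap x) := by
  have h : (pq x 1 : ℝ) + gaussMap x = 1 / x := by
    have h0 : 0 ≤ 1 / x := by have := hx.1; positivity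
    simp only [pq, gaussMap, Nat.sub_self, Function.iterate_zero, id]
    rw [natCast_floor_eq_intCast_floor h0]
    exact Int.floor_add_fract _
  rw [h, one_div_one_div]

theorem one_div_add_sub_one_div_add {a x y : ℝ} (hx : a + x ≠ 0) (hy : a + y ≠ 0) :
    1 / (a + x) - 1 / (a + y) = (y - x) * (1 / (a + x) * (1 / (a + y))) := by
  field_simp
  ring

/-- Points sharing their first `m` partial quotients are close. -/
theorem abs_sub_le_of_pq_eq {x y : ℝ} (hx : x ∈ Ioo (0 : ℝ) 1 ∧ Irrational x)
    (hy : y ∈ Ioo (0 : ℝ) 1 ∧ Irrational y) (m : ℕ)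
    (h : ∀ i < m, pq x (i + 1) = pq y (i + 1)) :
    |x - y| ≤ ∏ i ∈ Finset.range m, ((pq x (i + 1) : ℝ) ^ 2)⁻¹ := by
  induction m generalizing x y with
  | zero =>
    rw [Finset.prod_range_zero, abs_le]
    constructor <;> linarith [hx.1.1, hx.1.2, hy.1.1, hy.1.2]
  | succ m ih =>
    have hx' := gaussMap_mem hx
    have hy' := gaussMap_mem hy
    have h1 : (1 : ℝ) ≤ pq x 1 := by exact_mod_cast one_le_pq hx 1
    have hd := ih hx' hy' fun i hi => h (i + 1) (by omega)
    simp only [← pq_add_two] at hd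
    rw [Finset.prod_range_succ', zero_add]
    have e : x - y = (gaussMap y - gaussMap x) *
        (1 / (pq x 1 + gaussMap x) * (1 / (pq x 1 + gaussMap y))) := by
      rw [← one_div_add_sub_one_div_add (by linarith [hx'.1.1]) (by linarith [hy'.1.1]),
        ← eq_one_div_pq_add hx.1, ← zero_add 1, h 0 (by omega), zero_add, ← eq_one_div_pq_add hy.1]
    rw [e, abs_mul, abs_sub_comm]
    have hb : ∀ z : ℝ, 0 < z → 0 ≤ 1 / (pq x 1 + z) ∧ 1 / (pq x 1 + z) ≤ 1 / pq x 1 :=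
      fun z hz => ⟨by positivity, one_div_le_one_div_of_le (by linarith) (by linarith)⟩
    obtain ⟨p1, p2⟩ := hb _ hx'.1.1
    obtain ⟨q1, q2⟩ := hb _ hy'.1.1
    refine mul_le_mul hd ?_ (abs_nonneg _)
      (Finset.prod_nonneg fun i _ => inv_nonneg.2 (sq_nonneg _))
    rw [abs_of_nonneg (mul_nonneg p1 q1)]
    calc _ ≤ 1 / (pq x 1 : ℝ) * (1 / pq x 1) := mul_le_mul p2 q2 q1 (by positivity)
      _ = _ := by simp [sq]

theorem ENNReal.tsum_fin_prod (f : ℕ → ℝ≥0∞) (m : ℕ) :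
    ∑' w : Fin m → ℕ, ∏ i, f (w i) = (∑' n, f n) ^ m := by
  induction m with
  | zero => simp
  | succ m ih =>
    rw [← (Fin.consEquiv fun _ : Fin (m + 1) => ℕ).tsum_eq, ENNReal.tsum_prod', pow_succ', ← ih,
      ← ENNReal.tsum_mul_right]
    congr 1
    ext a
    rw [← ENNReal.tsum_mul_left]
    congr 1
    ext w
    simp [Fin.consEquiv, Fin.prod_univ_succ]

theorem dimH_le_of_pow_le_prod_pq {s : ℝ} (hs : 1 / 2 < s) : ∃ K : ℝ, ∀ (E : Set ℝ) (m₀ : ℕ),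
    (∀ x ∈ E, (x ∈ Ioo (0 : ℝ) 1 ∧ Irrational x) ∧
      ∀ m ≥ m₀, K ^ m ≤ ∏ i ∈ Finset.range m, (pq x (i + 1) : ℝ)) →
    dimH E ≤ ENNReal.ofReal s := by
  set Z : ℝ≥0∞ := ∑' n : ℕ, ENNReal.ofReal ((n : ℝ) ^ (-(s + 1 / 2))) with hZ
  have hZfin : Z ≠ ⊤ := by
    have := (Real.summable_nat_rpow (p := -(s + 1 / 2))).2 (by linarith)
    rw [hZ, ← ENNReal.ofReal_tsum_of_nonneg (fun n => by positivity) this]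
    exact ENNReal.ofReal_ne_top
  have ht : 0 < s - 1 / 2 := by linarith
  obtain ⟨K, hK, hK2⟩ := (((tendsto_rpow_atTop ht).eventually_ge_atTop (2 * Z.toReal)).and
    (eventually_ge_atTop 2)).exists
  have hK0 : 0 < K := by linarith
  refine ⟨K, fun E m₀ hE => ?_⟩
  set t : ∀ m : ℕ, (Fin m → ℕ) → Set ℝ := fun m w => {x ∈ E | ∀ i : Fin m, pq x (i + 1) = w i}
  have hcover : ∀ m, E ⊆ ⋃ w, t m w := fun m x hx =>
    mem_iUnion.2 ⟨fun i => pq x (i + 1), hx, fun _ => rfl⟩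
  have hdiam : ∀ m w x, x ∈ t m w →
      Metric.ediam (t m w) ≤ ENNReal.ofReal ((∏ i, (w i : ℝ)) ^ 2)⁻¹ := by
    intro m w x _
    refine Metric.ediam_le fun y hy z hz => ?_
    rw [edist_dist, Real.dist_eq]
    apply ENNReal.ofReal_le_ofReal
    refine (abs_sub_le_of_pq_eq (hE y hy.1).1 (hE z hz.1).1 m fun i hi =>
      (hy.2 ⟨i, hi⟩).trans (hz.2 ⟨i, hi⟩).symm).trans_eq ?_
    rw [← Finset.prod_pow, ← Finset.prod_inv_distrib, ← Fin.prod_univ_eq_prod_range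
      fun i => ((pq y (i + 1) : ℝ) ^ 2)⁻¹]
    exact Finset.prod_congr rfl fun i _ => by rw [hy.2 i]
  have hprod : ∀ m ≥ m₀, ∀ w x, x ∈ t m w → K ^ m ≤ ∏ i, (w i : ℝ) := by
    intro m hm w x hx
    refine ((hE x hx.1).2 m hm).trans_eq ?_
    rw [← Fin.prod_univ_eq_prod_range fun i => (pq x (i + 1) : ℝ)]
    exact Finset.prod_congr rfl fun i _ => by rw [hx.2 i]
  have hterm : ∀ m ≥ m₀, ∀ w, Metric.ediam (t m w) ^ s ≤
      ENNReal.ofReal ((K ^ m) ^ (-(s - 1 / 2))) *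
        ∏ i, ENNReal.ofReal ((w i : ℝ) ^ (-(s + 1 / 2))) := by
    intro m hm w
    rcases (t m w).eq_empty_or_nonempty with h0 | ⟨x, hx⟩
    · rw [h0, Metric.ediam_empty, ENNReal.zero_rpow_of_pos (by linarith)]
      exact zero_le
    · have hP := hprod m hm w x hx
      have hKm : 0 < K ^ m := by positivity
      set P := ∏ i, (w i : ℝ) with hPdef
      have hP0 : 0 < P := hKm.trans_le hP
      calc Metric.ediam (t m w) ^ s ≤ ENNReal.ofReal (P ^ 2)⁻¹ ^ s :=
            ENNReal.rpow_le_rpow (hdiam m w x hx) (by linarith)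
        _ = ENNReal.ofReal (P ^ (-(s - 1 / 2)) * P ^ (-(s + 1 / 2))) := by
            rw [ENNReal.ofReal_rpow_of_pos (by positivity), ← Real.rpow_add hP0,
              ← Real.rpow_natCast, ← Real.rpow_neg hP0.le, ← Real.rpow_mul hP0.le]
            congr 2
            push_cast
            ring
        _ ≤ ENNReal.ofReal ((K ^ m) ^ (-(s - 1 / 2)) * P ^ (-(s + 1 / 2))) := by
            apply ENNReal.ofReal_le_ofReal
            gcongr ?_ * _
            exact Real.rpow_le_rpow_of_nonpos hKm hP (by linarith)
        _ = _ := by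
            rw [ENNReal.ofReal_mul (by positivity), hPdef,
              ← Real.finsetProd_rpow _ _ fun i _ => by positivity,
              ENNReal.ofReal_prod_of_nonneg fun i _ => by positivity]
  have hsum : ∀ m ≥ m₀, ∑' w, Metric.ediam (t m w) ^ s ≤ (2⁻¹ : ℝ≥0∞) ^ m := by
    intro m hm
    calc _ ≤ ∑' w : Fin m → ℕ, ENNReal.ofReal ((K ^ m) ^ (-(s - 1 / 2))) *
          ∏ i, ENNReal.ofReal ((w i : ℝ) ^ (-(s + 1 / 2))) := ENNReal.tsum_le_tsum (hterm m hm)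
      _ = (ENNReal.ofReal (K ^ (-(s - 1 / 2))) * Z) ^ m := by
          rw [ENNReal.tsum_mul_left,
            ENNReal.tsum_fin_prod fun n : ℕ => ENNReal.ofReal ((n : ℝ) ^ (-(s + 1 / 2))), mul_pow,
            ← ENNReal.ofReal_pow (by positivity), ← Real.rpow_natCast, ← Real.rpow_natCast,
            ← Real.rpow_mul hK0.le, ← Real.rpow_mul hK0.le, mul_comm (m : ℝ)]
      _ ≤ _ := by
          gcongr
          rw [← ENNReal.ofReal_toReal hZfin, ← ENNReal.ofReal_mul (by positivity),
            ← ENNReal.ofReal_ofNat, ← ENNReal.ofReal_inv_of_pos (by norm_num)]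
          apply ENNReal.ofReal_le_ofReal
          rw [Real.rpow_neg hK0.le, inv_mul_le_iff₀ (by positivity)]
          linarith
  have hmeas : MeasureTheory.Measure.hausdorffMeasure s E = 0 := by
    refine le_antisymm ?_ zero_le
    refine (MeasureTheory.Measure.hausdorffMeasure_le_liminf_tsum (l := atTop) s E
      (fun m => ENNReal.ofReal (((K ^ m) ^ 2)⁻¹)) ?_ t ?_
      (Eventually.of_forall hcover)).trans ?_
    · rw [← ENNReal.ofReal_zero]
      refine ENNReal.tendsto_ofReal ?_
      have : Tendsto (fun m : ℕ => ((K ^ 2)⁻¹) ^ m) atTop (nhds 0) :=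
        tendsto_pow_atTop_nhds_zero_of_lt_one (by positivity)
          (inv_lt_one_of_one_lt₀ (by nlinarith))
      refine this.congr fun m => ?_
      rw [inv_pow, ← pow_mul, ← pow_mul, mul_comm]
    · filter_upwards [eventually_ge_atTop m₀] with m hm w
      rcases (t m w).eq_empty_or_nonempty with h0 | ⟨x, hx⟩
      · rw [h0, Metric.ediam_empty]
        exact zero_le
      · refine (hdiam m w x hx).trans (ENNReal.ofReal_le_ofReal ?_)
        have := hprod m hm w x hx
        gcongr
    · have h2 : Tendsto (fun m : ℕ => (2⁻¹ : ℝ≥0∞) ^ m) atTop (nhds 0) :=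
        ENNReal.tendsto_pow_atTop_nhds_zero_of_lt_one (by simp)
      rw [← h2.liminf_eq]
      exact liminf_le_liminf ((eventually_ge_atTop m₀).mono hsum)
  refine dimH_le_of_hausdorffMeasure_ne_top (d := s.toNNReal) ?_
  rw [Real.coe_toNNReal _ (by linarith), hmeas]
  exact ENNReal.zero_ne_top

/-- If the geometric means of the partial quotients tend to infinity on `E`, then the dimension
of `E` is at most `1 / 2`. -/
theorem dimH_le_half_of_pow_le_prod_pq {E : Set ℝ}
    (hE : ∀ x ∈ E, x ∈ Ioo (0 : ℝ) 1 ∧ Irrational x)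
    (h : ∀ x ∈ E, ∀ K : ℝ, ∀ᶠ m in atTop, K ^ m ≤ ∏ i ∈ Finset.range m, (pq x (i + 1) : ℝ)) :
    dimH E ≤ 1 / 2 := by
  have key : ∀ s : ℝ, 1 / 2 < s → dimH E ≤ ENNReal.ofReal s := by
    intro s hs
    obtain ⟨K, hK⟩ := dimH_le_of_pow_le_prod_pq hs
    have hsub : E ⊆ ⋃ m₀ : ℕ, {x ∈ E | ∀ m ≥ m₀,
        K ^ m ≤ ∏ i ∈ Finset.range m, (pq x (i + 1) : ℝ)} := by
      intro x hx
      obtain ⟨m₀, hm₀⟩ := eventually_atTop.1 (h x hx K)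
      exact mem_iUnion.2 ⟨m₀, hx, hm₀⟩
    refine (dimH_mono hsub).trans ?_
    rw [dimH_iUnion]
    exact iSup_le fun m₀ => hK _ m₀ fun x hx => ⟨hE x hx.1, hx.2⟩
  have hhalf : (1 / 2 : ℝ≥0∞) = ENNReal.ofReal (1 / 2) := by
    rw [ENNReal.ofReal_div_of_pos (by norm_num)]
    simp
  rw [hhalf]
  refine ge_of_tendsto (x := nhdsWithin (1 / 2 : ℝ) (Ioi (1 / 2)))
    (f := fun s => ENNReal.ofReal s) ?_ ?_
  · exact (ENNReal.tendsto_ofReal tendsto_id).mono_left nhdsWithin_le_nhds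
  · filter_upwards [self_mem_nhdsWithin] with s hs using key s hs

/-- A record process with jumps bounded by `D` is controlled by the sum of its record values. -/
theorem sq_le_sq_add_sum_of_records {M b : ℕ → ℝ} {D : ℝ} {N : ℕ} (hb : ∀ n, 0 ≤ b n)
    (hM : ∀ n, 0 ≤ M n) (hmono : Monotone M)
    (hrec : ∀ n, M (n + 1) = M n ∨ M (n + 1) = b n)
    (hD : ∀ n ≥ N, M (n + 1) - M n ≤ D) (n : ℕ) (hn : N ≤ n) :
    M n ^ 2 ≤ M N ^ 2 + 2 * D * ∑ i ∈ Finset.range n, b i := by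
  have hD0 : 0 ≤ D := (sub_nonneg.2 (hmono N.le_succ)).trans (hD N le_rfl)
  induction n, hn using Nat.le_induction with
  | base =>
    have := Finset.sum_nonneg fun i (_ : i ∈ Finset.range N) => hb i
    nlinarith [mul_nonneg hD0 this]
  | succ n hn ih =>
    rw [Finset.sum_range_succ]
    have h1 := hD n hn
    have h2 := hmono n.le_succ
    rcases hrec n with h | h
    · rw [h]
      nlinarith [mul_nonneg hD0 (hb n)]
    · have : M (n + 1) ^ 2 - M n ^ 2 ≤ 2 * D * b n := by
        rw [← h]
        nlinarith [hM n, hM (n + 1), mul_nonneg (sub_nonneg.2 h1) (hM (n + 1)),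
          mul_nonneg (sub_nonneg.2 h2) (sub_nonneg.2 h2)]
      linarith

theorem Lmax_succ (x : ℝ) (n : ℕ) :
    Lmax x (n + 1) = max (pq x (n + 1) * pq x (n + 2)) (Lmax x n) := by
  rw [Lmax, ← Finset.insert_Icc_right_eq_Icc_add_one (by omega), Finset.sup_insert]
  rfl

theorem pow_le_prod_pq_of_mem_Lset {ℓ : ℕ → ℝ} (hpos : ∀ᶠ n in atTop, 0 < ℓ n)
    (hdiff : Tendsto (fun n => Real.log (ℓ (n + 1)) - Real.log (ℓ n)) atTop (nhds 0))
    (hsqrt : Tendsto (fun n : ℕ => Real.log (ℓ n) / √n) atTop atTop)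
    {x : ℝ} (hx : x ∈ Lset ℓ) (K : ℝ) :
    ∀ᶠ m in atTop, K ^ m ≤ ∏ i ∈ Finset.range m, (pq x (i + 1) : ℝ) := by
  obtain ⟨hx0, hx1, hlim⟩ := hx
  have hpq : ∀ n, (1 : ℝ) ≤ pq x n := fun n => by exact_mod_cast one_le_pq ⟨hx0, hx1⟩ n
  set M : ℕ → ℝ := fun n => Real.log (Lmax x n) with hMdef
  set b : ℕ → ℝ := fun n => Real.log (pq x (n + 1) * pq x (n + 2)) with hbdef
  have hLpos : ∀ n, 1 ≤ n → 1 ≤ Lmax x n := by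
    intro n hn
    refine le_trans ?_ (Finset.le_sup (f := fun i => pq x i * pq x (i + 1))
      (Finset.mem_Icc.2 ⟨le_rfl, hn⟩))
    exact Nat.mul_pos (one_le_pq ⟨hx0, hx1⟩ _) (one_le_pq ⟨hx0, hx1⟩ _)
  have hM0 : ∀ n, 0 ≤ M n := fun n => Real.log_natCast_nonneg _
  have hb0 : ∀ n, 0 ≤ b n := fun n => Real.log_nonneg (by nlinarith [hpq (n + 1), hpq (n + 2)])
  have hrec : ∀ n, M (n + 1) = M n ∨ M (n + 1) = b n := by
    intro n
    simp only [hMdef, hbdef, Lmax_succ]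
    rcases max_choice (pq x (n + 1) * pq x (n + 2)) (Lmax x n) with h | h
    · right; rw [h]; push_cast; rfl
    · left; rw [h]
  have hmono : Monotone M := by
    refine monotone_nat_of_le_succ fun n => ?_
    rcases Nat.eq_zero_or_pos n with rfl | hn
    · simpa [hMdef, Lmax] using hM0 1
    · refine Real.log_le_log (by exact_mod_cast hLpos n hn) ?_
      rw [Lmax_succ]
      exact_mod_cast le_max_right _ _
  have hMlog : Tendsto (fun n => M n - Real.log (ℓ n)) atTop (nhds 0) := by
    have := (Real.continuousAt_log one_ne_zero).tendsto.comp hlim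
    rw [Real.log_one] at this
    refine this.congr' ?_
    filter_upwards [hpos, eventually_ge_atTop 1] with n hn h1
    have : (Lmax x n : ℝ) ≠ 0 := by
      have := hLpos n h1
      positivity
    exact Real.log_div this hn.ne'
  have hMdiff : Tendsto (fun n => M (n + 1) - M n) atTop (nhds 0) := by
    have := ((hMlog.comp (tendsto_add_atTop_nat 1)).sub hMlog).add hdiff
    simp only [sub_zero, add_zero] at this
    refine this.congr fun n => ?_
    simp only [Function.comp]
    ring
  obtain ⟨N, hN⟩ := eventually_atTop.1 (hMdiff.eventually_le_const (u := 1) (by norm_num))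
  have hrecords := sq_le_sq_add_sum_of_records hb0 hM0 hmono hrec hN
  set B := |K| with hB
  have hB0 : 0 ≤ B := abs_nonneg K
  have hsum : ∀ n, ∑ i ∈ Finset.range n, b i ≤
      2 * ∑ i ∈ Finset.range (n + 1), Real.log (pq x (i + 1)) := by
    intro n
    have e : ∑ i ∈ Finset.range n, b i = ∑ i ∈ Finset.range n, Real.log (pq x (i + 1)) +
        ∑ i ∈ Finset.range n, Real.log (pq x (i + 2)) := by
      rw [← Finset.sum_add_distrib]
      refine Finset.sum_congr rfl fun i _ => Real.log_mul ?_ ?_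
      · linarith [hpq (i + 1)]
      · linarith [hpq (i + 2)]
    have e1 := Finset.sum_range_succ (fun i => Real.log (pq x (i + 1))) n
    have e2 := Finset.sum_range_succ' (fun i => Real.log (pq x (i + 1))) n
    have n1 := Real.log_nonneg (hpq (n + 1))
    have n2 := Real.log_nonneg (hpq (0 + 1))
    linarith
  have key : ∀ᶠ n in atTop, K ^ (n + 1) ≤ ∏ i ∈ Finset.range (n + 1), (pq x (i + 1) : ℝ) := by
    filter_upwards [hMlog.eventually_const_le (u := -1) (by norm_num),
      hsqrt.eventually_ge_atTop (8 * B + 2), eventually_ge_atTop (max N 1),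
      tendsto_natCast_atTop_atTop.eventually_ge_atTop (M N ^ 2)] with n h1 h2 h3 h4
    have hn1 : (1 : ℝ) ≤ n := by exact_mod_cast (le_max_right N 1).trans h3
    have hs1 : 1 ≤ √(n : ℝ) := Real.one_le_sqrt.2 hn1
    rw [le_div_iff₀ (by linarith)] at h2
    have hMn : (8 * B + 1) * √n ≤ M n := by linarith
    have hMn2 : (8 * B + 1) * n ≤ M n ^ 2 := by
      have := pow_le_pow_left₀ (by positivity) hMn 2
      rw [mul_pow, Real.sq_sqrt (by linarith)] at this
      nlinarith [mul_nonneg hB0 hB0, mul_nonneg (mul_nonneg hB0 hB0) (Nat.cast_nonneg (α := ℝ) n),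
        mul_nonneg hB0 (Nat.cast_nonneg (α := ℝ) n)]
    have hlog : B * (n + 1) ≤ ∑ i ∈ Finset.range (n + 1), Real.log (pq x (i + 1)) := by
      have := hrecords n ((le_max_left N 1).trans h3)
      have := hsum n
      nlinarith [mul_nonneg hB0 (sub_nonneg.2 hn1)]
    rw [← Real.log_prod fun i _ => by linarith [hpq (i + 1)]] at hlog
    calc K ^ (n + 1) ≤ |K| ^ (n + 1) := (le_abs_self _).trans (abs_pow K _).le
      _ ≤ Real.exp B ^ (n + 1) := by
          gcongr
          linarith [Real.add_one_le_exp B]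
      _ = Real.exp (B * (n + 1)) := by
          rw [← Real.exp_nat_mul]
          push_cast
          ring_nf
      _ ≤ _ := by
          rw [← Real.le_log_iff_exp_le
            (Finset.prod_pos fun i _ => by linarith [hpq (i + 1)])]
          exact hlog
  filter_upwards [(tendsto_sub_atTop_nat 1).eventually key, eventually_ge_atTop 1] with m hm h1
  rwa [Nat.sub_add_cancel h1] at hm

theorem RegInc.tendsto_sqrt_mul_sub {R : ℝ → ℝ} (hR : RegInc R 0) :
    Tendsto (fun n : ℕ => √((n + 1 : ℕ) : ℝ) * R (n + 1 : ℕ) - √(n : ℝ) * R n) atTop (nhds 0) := by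
  obtain ⟨c, hc, f', hpos, hder, -, hf', -, hlim⟩ := hR
  obtain ⟨X, hX⟩ := eventually_atTop.1 ((hlim.eventually_le_const (u := 1 / 4)
    (by norm_num)).and (eventually_ge_atTop (max c 1)))
  have hXc : ∀ x ≥ X, c ≤ x := fun x hx => (le_max_left c 1).trans (hX x hx).2
  have hX1 : ∀ x ≥ X, 1 ≤ x := fun x hx => (le_max_right c 1).trans (hX x hx).2
  have hderiv : ∀ x ≥ X, x * f' x ≤ R x / 4 := fun x hx => by
    have := (div_le_iff₀ (hpos x (hXc x hx))).1 (hX x hx).1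
    linarith
  have hquot : ∀ x ≥ X, HasDerivAt (fun y => R y * y ^ (-(1 / 4) : ℝ))
      (f' x * x ^ (-(1 / 4) : ℝ) + R x * (-(1 / 4) * x ^ (-(1 / 4) - 1 : ℝ))) x := fun x hx =>
    (hder x (hXc x hx)).mul (Real.hasDerivAt_rpow_const (Or.inl (by linarith [hX1 x hx])))
  have hanti : AntitoneOn (fun y => R y * y ^ (-(1 / 4) : ℝ)) (Ici X) := by
    refine antitoneOn_of_hasDerivWithinAt_nonpos (convex_Ici X)
      (fun x hx => (hquot x hx).continuousAt.continuousWithinAt)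
      (fun x hx => (hquot x (interior_subset hx)).hasDerivWithinAt) fun x hx => ?_
    have hx := interior_subset hx
    have hx0 : 0 < x := by linarith [hX1 x hx]
    have e : x ^ (-(1 / 4) : ℝ) = x * x ^ (-(1 / 4) - 1 : ℝ) := by
      rw [Real.rpow_sub_one hx0.ne']
      field_simp
    rw [e]
    have := hderiv x hx
    have hp : 0 < x ^ (-(1 / 4) - 1 : ℝ) := by positivity
    nlinarith [mul_nonneg (sub_nonneg.2 this) hp.le]
  set C := R X * X ^ (-(1 / 4) : ℝ)
  have hbound : ∀ x ≥ X, R x ≤ C * x ^ (1 / 4 : ℝ) := by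
    intro x hx
    have hx0 : 0 < x := by linarith [hX1 x hx]
    have := hanti self_mem_Ici hx hx
    simp only [Real.rpow_neg hx0.le] at this
    rwa [← div_eq_mul_inv, div_le_iff₀ (by positivity)] at this
  have hC : 0 ≤ C := mul_nonneg (hpos X (hXc X le_rfl)).le
    (by have := hX1 X le_rfl; positivity)
  have hprod : ∀ x ≥ X, HasDerivAt (fun y => √y * R y) (1 / (2 * √x) * R x + √x * f' x) x :=
    fun x hx => (Real.hasDerivAt_sqrt (by linarith [hX1 x hx])).mul (hder x (hXc x hx))
  have hzero : Tendsto (fun n : ℕ => C * (n : ℝ) ^ (-(1 / 4) : ℝ)) atTop (nhds 0) := by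
    simpa using ((tendsto_rpow_neg_atTop (y := 1 / 4) (by norm_num)).comp
      tendsto_natCast_atTop_atTop).const_mul C
  have hmvt : ∀ᶠ n : ℕ in atTop,
      0 ≤ √((n + 1 : ℕ) : ℝ) * R (n + 1 : ℕ) - √(n : ℝ) * R n ∧
      √((n + 1 : ℕ) : ℝ) * R (n + 1 : ℕ) - √(n : ℝ) * R n ≤ C * (n : ℝ) ^ (-(1 / 4) : ℝ) := by
    filter_upwards [tendsto_natCast_atTop_atTop.eventually_ge_atTop X] with n hn
    have hlt : (n : ℝ) < (n + 1 : ℕ) := by push_cast; linarith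
    obtain ⟨ξ, hξ, e⟩ := exists_hasDerivAt_eq_slope (fun y => √y * R y) _ hlt
      (fun y hy => (hprod y (hn.trans hy.1)).continuousAt.continuousWithinAt)
      (fun y hy => hprod y (hn.trans hy.1.le))
    have hlen : ((n + 1 : ℕ) : ℝ) - n = 1 := by push_cast; ring
    rw [hlen, div_one] at e
    rw [← e]
    have hξX : X ≤ ξ := hn.trans hξ.1.le
    have hξ0 : 0 < ξ := by linarith [hX1 ξ hξX]
    have hRξ := hpos ξ (hXc ξ hξX)
    have hf'ξ := hf' ξ (hXc ξ hξX)
    have hn0 : 0 < (n : ℝ) := by linarith [hX1 n hn]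
    refine ⟨by positivity, ?_⟩
    have hs : 0 < √ξ := Real.sqrt_pos.2 hξ0
    calc 1 / (2 * √ξ) * R ξ + √ξ * f' ξ = (R ξ / 2 + ξ * f' ξ) / √ξ := by
          field_simp
          rw [Real.sq_sqrt hξ0.le]
          ring
      _ ≤ (C * ξ ^ (1 / 4 : ℝ)) / √ξ := by
          gcongr
          linarith [hderiv ξ hξX, hbound ξ hξX]
      _ = C * ξ ^ (-(1 / 4) : ℝ) := by
          rw [Real.sqrt_eq_rpow, mul_div_assoc, ← Real.rpow_sub hξ0]
          norm_num
      _ ≤ C * (n : ℝ) ^ (-(1 / 4) : ℝ) :=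
          mul_le_mul_of_nonneg_left
            (Real.rpow_le_rpow_of_nonpos hn0 hξ.1.le (by norm_num)) hC
  exact squeeze_zero' (hmvt.mono fun _ h => h.1) (hmvt.mono fun _ h => h.2) hzero

theorem abs_one_div_add_sub_le {a u v : ℝ} (ha : 2 ≤ a) (hu : 0 ≤ u) (hv : 0 ≤ v) :
    |1 / (a + u) - 1 / (a + v)| ≤ 1 / 4 * |u - v| := by
  have h : ∀ w : ℝ, 0 ≤ w → 0 ≤ 1 / (a + w) ∧ 1 / (a + w) ≤ 1 / 2 := fun w hw =>
    ⟨by positivity, one_div_le_one_div_of_le (by norm_num) (by linarith)⟩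
  rw [one_div_add_sub_one_div_add (by positivity) (by positivity), abs_mul, abs_sub_comm,
    abs_of_nonneg (mul_nonneg (h u hu).1 (h v hv).1), mul_comm]
  gcongr
  nlinarith [h u hu, h v hv]

theorem exists_seq_eq_one_div_add (a : ℕ → ℕ) (ha : ∀ k, 2 ≤ a k) :
    ∃ X : ℕ → ℝ, ∀ k, 0 ≤ X k ∧ X k = 1 / (a k + X (k + 1)) := by
  have ha' : ∀ k, (2 : ℝ) ≤ a k := fun k => by exact_mod_cast ha k
  set Y : ℕ → ℕ → ℝ := fun n => n.rec (fun _ => 0) fun _ f k => 1 / (a k + f (k + 1))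
  have Y0 : ∀ k, Y 0 k = 0 := fun _ => rfl
  have Ys : ∀ n k, Y (n + 1) k = 1 / (a k + Y n (k + 1)) := fun _ _ => rfl
  have hnn : ∀ n k, 0 ≤ Y n k := by
    intro n
    induction n with
    | zero => intro k; exact le_rfl
    | succ n ih => intro k; rw [Ys]; have := ih (k + 1); positivity
  have hd : ∀ n k, |Y n k - Y (n + 1) k| ≤ 1 * (1 / 4) ^ n := by
    intro n
    induction n with
    | zero =>
      intro k
      rw [Y0, Ys, Y0, zero_sub, abs_neg, add_zero, pow_zero, mul_one, abs_of_nonneg (by positivity),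
        div_le_one (by linarith [ha' k])]
      linarith [ha' k]
    | succ n ih =>
      intro k
      rw [Ys n, Ys (n + 1)]
      refine (abs_one_div_add_sub_le (ha' k) (hnn n (k + 1)) (hnn (n + 1) (k + 1))).trans ?_
      have := ih (k + 1)
      rw [pow_succ]
      linarith
  have hconv : ∀ k, ∃ l, Tendsto (fun n => Y n k) atTop (nhds l) := fun k =>
    cauchySeq_tendsto_of_complete (cauchySeq_of_le_geometric (1 / 4) 1 (by norm_num) (hd · k))
  choose X hX using hconv
  have hX0 : ∀ k, 0 ≤ X k := fun k => ge_of_tendsto' (hX k) fun n => hnn n k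
  refine ⟨X, fun k => ⟨hX0 k, ?_⟩⟩
  refine tendsto_nhds_unique ((hX k).comp (tendsto_add_atTop_nat 1)) ?_
  have hne : (a k : ℝ) + X (k + 1) ≠ 0 := by linarith [ha' k, hX0 (k + 1)]
  exact tendsto_const_nhds.div ((hX (k + 1)).const_add (a k : ℝ)) hne

theorem irrational_of_eq_one_div_add {a : ℕ → ℕ} {X : ℕ → ℝ}
    (hX : ∀ k, X k ∈ Ioo (0 : ℝ) 1 ∧ X k = 1 / (a k + X (k + 1))) (k : ℕ) :
    Irrational (X k) := by
  have key : ∀ q : ℕ, ∀ k, ∀ p : ℤ, X k * q = p → q = 0 := by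
    intro q
    induction q using Nat.strong_induction_on with
    | _ q ih =>
      intro k p hp
      by_contra hq
      have hq0 : (0 : ℝ) < q := by positivity
      obtain ⟨⟨h0, h1⟩, e⟩ := hX k
      have hs := (hX (k + 1)).1.1
      have hp0 : 0 < p := by
        have : (0 : ℝ) < p := by rw [← hp]; positivity
        exact_mod_cast this
      have hpq : p < q := by
        have : (p : ℝ) < q := by rw [← hp]; nlinarith
        exact_mod_cast this
      lift p to ℕ using hp0.le
      have hpR : (0 : ℝ) < p := by exact_mod_cast hp0
      refine hp0.ne' ?_
      have := ih p (by exact_mod_cast hpq) (k + 1) (q - a k * p) ?_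
      · exact_mod_cast this
      · rw [e] at hp
        have hne : (a k : ℝ) + X (k + 1) ≠ 0 := by positivity
        field_simp at hp
        push_cast at hp ⊢
        linarith
  rintro ⟨r, hr⟩
  refine r.den_ne_zero (key r.den k r.num ?_)
  rw [← hr]
  exact_mod_cast Rat.mul_den_eq_num r

theorem gaussMap_one_div_add {a : ℕ} {t : ℝ} (ht : t ∈ Ioo (0 : ℝ) 1) :
    gaussMap (1 / (a + t)) = t := by
  rw [gaussMap, one_div_one_div, Int.fract_natCast_add, Int.fract_eq_self.2 ⟨ht.1.le, ht.2⟩]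

/-- Every sequence of integers `≥ 2` is the sequence of partial quotients of an irrational; `X k`
is the image of that irrational under the `k`-th iterate of the Gauss map. -/
theorem exists_seq_pq_eq (a : ℕ → ℕ) (ha : ∀ k, 2 ≤ a k) :
    ∃ X : ℕ → ℝ, (∀ k, 0 ≤ X k ∧ X k ≤ 1 / 2 ∧ X k = 1 / (a k + X (k + 1))) ∧
      (X 0 ∈ Ioo (0 : ℝ) 1 ∧ Irrational (X 0)) ∧ ∀ k, pq (X 0) (k + 1) = a k := by
  obtain ⟨X, hX⟩ := exists_seq_eq_one_div_add a ha
  have ha' : ∀ k, (2 : ℝ) ≤ a k := fun k => by exact_mod_cast ha k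
  have hhalf : ∀ k, X k ≤ 1 / 2 := fun k => by
    rw [(hX k).2]
    exact one_div_le_one_div_of_le (by norm_num) (by linarith [ha' k, (hX (k + 1)).1])
  have hpos : ∀ k, 0 < X k := fun k => by
    rw [(hX k).2]
    have := (hX (k + 1)).1
    have := ha' k
    positivity
  have hmem : ∀ k, X k ∈ Ioo (0 : ℝ) 1 := fun k => ⟨hpos k, by linarith [hhalf k]⟩
  have hit : ∀ k, gaussMap^[k] (X 0) = X k := by
    intro k
    induction k with
    | zero => rfl
    | succ k ih =>
      rw [Function.iterate_succ_apply', ih, (hX k).2, gaussMap_one_div_add (hmem _)]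
  refine ⟨X, fun k => ⟨(hX k).1, hhalf k, (hX k).2⟩, ⟨hmem 0,
    irrational_of_eq_one_div_add (fun k => ⟨hmem k, (hX k).2⟩) 0⟩, fun k => ?_⟩
  rw [pq, Nat.add_sub_cancel, hit, (hX k).2, one_div_one_div, add_comm,
    Nat.floor_add_natCast (hmem _).1.le, Nat.floor_eq_zero.2 (hmem _).2, zero_add]

/-- Continued fractions that first differ at the `n`-th partial quotient are well separated. -/
theorem half_mul_prod_le_abs_sub {a a' : ℕ → ℕ} {X X' A : ℕ → ℝ}
    (hX : ∀ k, 0 ≤ X k ∧ X k ≤ 1 / 2 ∧ X k = 1 / (a k + X (k + 1)))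
    (hX' : ∀ k, 0 ≤ X' k ∧ X' k ≤ 1 / 2 ∧ X' k = 1 / (a' k + X' (k + 1)))
    (ha : ∀ k, 2 ≤ a k) (ha' : ∀ k, 2 ≤ a' k)
    (hA : ∀ k, (a k : ℝ) + 1 ≤ A k) (hA' : ∀ k, (a' k : ℝ) + 1 ≤ A k)
    (n k : ℕ) (heq : ∀ i < n, a (k + i) = a' (k + i)) (hne : a (k + n) ≠ a' (k + n)) :
    1 / 2 * ∏ i ∈ Finset.range (n + 1), ((A (k + i)) ^ 2)⁻¹ ≤ |X k - X' k| := by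
  have lower : ∀ {a : ℕ → ℕ} {X : ℕ → ℝ}, (∀ k, 2 ≤ a k) → (∀ k, (a k : ℝ) + 1 ≤ A k) →
      (∀ k, 0 ≤ X k ∧ X k ≤ 1 / 2 ∧ X k = 1 / (a k + X (k + 1))) → ∀ k, 1 / A k ≤ X k := by
    intro a X ha hA hX k
    have : (2 : ℝ) ≤ a k := by exact_mod_cast ha k
    rw [(hX k).2.2]
    exact one_div_le_one_div_of_le (by linarith [hX (k + 1)]) (by linarith [hA k, hX (k + 1)])
  have hApos : ∀ k, 0 < A k := fun k => lt_of_lt_of_le (by positivity) (hA k)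
  have hsq : ∀ k, (A k ^ 2)⁻¹ ≤ X k * X' k := fun k => by
    calc (A k ^ 2)⁻¹ = 1 / A k * (1 / A k) := by simp [sq]
      _ ≤ _ := mul_le_mul (lower ha hA hX k) (lower ha' hA' hX' k)
          (one_div_nonneg.2 (hApos k).le) (hX k).1
  have hdiff : ∀ k, X k - X' k =
      ((a' k : ℝ) - a k + (X' (k + 1) - X (k + 1))) * (X k * X' k) := fun k => by
    have h1 : X k * (a k + X (k + 1)) = 1 := by
      have : (2 : ℝ) ≤ a k := by exact_mod_cast ha k
      rw [(hX k).2.2]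
      exact one_div_mul_cancel (by linarith [hX (k + 1)])
    have h2 : X' k * (a' k + X' (k + 1)) = 1 := by
      have : (2 : ℝ) ≤ a' k := by exact_mod_cast ha' k
      rw [(hX' k).2.2]
      exact one_div_mul_cancel (by linarith [hX' (k + 1)])
    linear_combination X' k * h1 - X k * h2
  have hnn : ∀ k, 0 ≤ X k * X' k := fun k => mul_nonneg (hX k).1 (hX' k).1
  induction n generalizing k with
  | zero =>
    rw [zero_add, Finset.prod_range_one, add_zero, hdiff k, abs_mul, abs_of_nonneg (hnn k)]
    refine mul_le_mul ?_ (hsq k) (inv_nonneg.2 (sq_nonneg _)) (abs_nonneg _)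
    have h1 : (1 : ℝ) ≤ |(a' k : ℝ) - a k| := by
      have : (1 : ℤ) ≤ |(a' k : ℤ) - a k| := Int.one_le_abs (by
        have : a k ≠ a' k := hne
        omega)
      exact_mod_cast this
    have h2 : |X' (k + 1) - X (k + 1)| ≤ 1 / 2 := by
      rw [abs_le]
      constructor <;> linarith [hX (k + 1), hX' (k + 1)]
    have h3 := abs_add_le ((a' k : ℝ) - a k + (X' (k + 1) - X (k + 1))) (-(X' (k + 1) - X (k + 1)))
    rw [abs_neg, add_neg_cancel_right] at h3
    linarith
  | succ n ih =>
    have h := ih (k + 1) (fun i hi => by simpa [add_assoc, add_comm 1] using heq (i + 1) (by omega))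
      (by simpa [add_assoc, add_comm 1] using hne)
    have h0 : a k = a' k := heq 0 (by omega)
    rw [Finset.prod_range_succ', add_zero, hdiff k, h0, sub_self, zero_add, abs_mul,
      abs_of_nonneg (hnn k), ← mul_assoc, abs_sub_comm]
    refine mul_le_mul ?_ (hsq k) (inv_nonneg.2 (sq_nonneg _)) (abs_nonneg _)
    refine le_trans (le_of_eq ?_) h
    simp only [add_assoc, add_comm 1]

/-- The `n`-th remainder of the expansion of `y` in the mixed radix system with bases `N`. -/
noncomputable def radixRem (N : ℕ → ℕ) (y : ℝ) (n : ℕ) : ℝ :=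
  n.rec y fun n t => Int.fract (N n * t)

/-- The `n`-th digit of `y` in the mixed radix system with bases `N`. -/
noncomputable def radixDigit (N : ℕ → ℕ) (y : ℝ) (n : ℕ) : ℕ := ⌊N n * radixRem N y n⌋₊

theorem radixRem_succ (N : ℕ → ℕ) (y : ℝ) (n : ℕ) :
    radixRem N y (n + 1) = Int.fract (N n * radixRem N y n) := rfl

theorem radixRem_mem {N : ℕ → ℕ} {y : ℝ} (hy : y ∈ Ico (0 : ℝ) 1) (n : ℕ) :
    radixRem N y n ∈ Ico (0 : ℝ) 1 := by
  cases n with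
  | zero => exact hy
  | succ n => exact ⟨Int.fract_nonneg _, Int.fract_lt_one _⟩

theorem radixDigit_lt {N : ℕ → ℕ} (hN : ∀ n, 1 ≤ N n) {y : ℝ} (hy : y ∈ Ico (0 : ℝ) 1) (n : ℕ) :
    radixDigit N y n < N n := by
  obtain ⟨h0, h1⟩ := radixRem_mem (N := N) hy n
  have : (1 : ℝ) ≤ N n := by exact_mod_cast hN n
  rw [radixDigit, Nat.floor_lt (by positivity)]
  nlinarith

theorem abs_sub_mul_prod_le_one {N : ℕ → ℕ} {y z : ℝ} (hy : y ∈ Ico (0 : ℝ) 1)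
    (hz : z ∈ Ico (0 : ℝ) 1) (n : ℕ) (h : ∀ i < n, radixDigit N y i = radixDigit N z i) :
    |y - z| * ∏ i ∈ Finset.range n, (N i : ℝ) ≤ 1 := by
  have key : ∀ m ≤ n, (y - z) * ∏ i ∈ Finset.range m, (N i : ℝ) =
      radixRem N y m - radixRem N z m := by
    intro m hm
    induction m with
    | zero => simp [radixRem]
    | succ m ih =>
      have hfl : ∀ {w : ℝ}, w ∈ Ico (0 : ℝ) 1 →
          (N m : ℝ) * radixRem N w m = radixDigit N w m + radixRem N w (m + 1) := fun {w} hw => by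
        have h0 : 0 ≤ (N m : ℝ) * radixRem N w m :=
          mul_nonneg (Nat.cast_nonneg _) (radixRem_mem hw m).1
        rw [radixDigit, radixRem_succ, natCast_floor_eq_intCast_floor h0, Int.floor_add_fract]
      have h1 := hfl hy
      have h2 := hfl hz
      rw [h m (by omega)] at h1
      rw [Finset.prod_range_succ]
      linear_combination (N m : ℝ) * ih (by omega) + h1 - h2
  have h0 : 0 ≤ ∏ i ∈ Finset.range n, (N i : ℝ) := by positivity
  rw [← abs_of_nonneg h0, ← abs_mul, key n le_rfl, abs_le]
  have h1 := radixRem_mem (N := N) hy n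
  have h2 := radixRem_mem (N := N) hz n
  constructor <;> linarith [h1.1, h1.2, h2.1, h2.2]

/-- A map on `[0, 1)` whose inverse is `s`-Hölder has image of dimension at least `s`. -/
theorem le_dimH_image_of_abs_sub_le {h : ℝ → ℝ} {C s : ℝ} (hC : 0 ≤ C) (hs : 0 < s)
    (hh : ∀ y ∈ Ico (0 : ℝ) 1, ∀ z ∈ Ico (0 : ℝ) 1, |y - z| ≤ C * |h y - h z| ^ s) :
    ENNReal.ofReal s ≤ dimH (h '' Ico 0 1) := by
  have hinj : InjOn h (Ico 0 1) := fun y hy z hz e => by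
    have := hh y hy z hz
    rw [e, sub_self, abs_zero, Real.zero_rpow hs.ne', mul_zero] at this
    exact sub_eq_zero.1 (abs_eq_zero.1 (le_antisymm this (abs_nonneg _)))
  set g := Function.invFunOn h (Ico 0 1)
  have hg : ∀ y ∈ Ico (0 : ℝ) 1, g (h y) = y := hinj.leftInvOn_invFunOn
  have hold : HolderOnWith C.toNNReal s.toNNReal g (h '' Ico 0 1) := by
    rintro _ ⟨y, hy, rfl⟩ _ ⟨z, hz, rfl⟩
    rw [hg y hy, hg z hz, edist_dist, edist_dist, Real.dist_eq, Real.dist_eq,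
      Real.coe_toNNReal _ hs.le, ENNReal.ofReal_rpow_of_nonneg (abs_nonneg _) hs.le,
      show (C.toNNReal : ℝ≥0∞) = ENNReal.ofReal C from rfl, ← ENNReal.ofReal_mul hC]
    exact ENNReal.ofReal_le_ofReal (hh y hy z hz)
  have himage : g '' (h '' Ico 0 1) = Ico 0 1 := by
    rw [image_image]
    exact (image_congr hg).trans (image_id' _)
  have h1 := hold.dimH_image_le (by simpa using hs)
  rw [himage, Real.dimH_of_nonempty_interior (by simp)] at h1
  have hs' : ENNReal.ofReal s ≠ 0 := by simpa using hs
  rw [show (s.toNNReal : ℝ≥0∞) = ENNReal.ofReal s from rfl,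
    ENNReal.le_div_iff_mul_le (Or.inl hs') (Or.inl ENNReal.ofReal_ne_top)] at h1
  simpa using h1

/-- Lower bound for the dimension of a set containing all continued fractions whose `n`-th partial
quotient ranges over `N n` consecutive integers. -/
theorem le_dimH_of_forall_pq_mem {N b : ℕ → ℕ} {A : ℕ → ℝ} {C s : ℝ} {E : Set ℝ}
    (hN : ∀ n, 1 ≤ N n) (hb : ∀ n, 2 ≤ b n) (hA : ∀ n, (b n : ℝ) + N n ≤ A n)
    (hC : 0 ≤ C) (hs : 0 < s)
    (hNtop : Tendsto (fun n => ∏ i ∈ Finset.range n, (N i : ℝ)) atTop atTop)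
    (hbound : ∀ n, (∏ i ∈ Finset.range n, (N i : ℝ))⁻¹ ≤
      C * (1 / 2 * ∏ i ∈ Finset.range (n + 1), ((A i) ^ 2)⁻¹) ^ s)
    (hE : ∀ x, (x ∈ Ioo (0 : ℝ) 1 ∧ Irrational x) →
      (∀ i, b i ≤ pq x (i + 1) ∧ pq x (i + 1) < b i + N i) → x ∈ E) :
    ENNReal.ofReal s ≤ dimH E := by
  have hex := fun y => exists_seq_pq_eq (fun n => b n + radixDigit N y n)
    fun n => (hb n).trans (Nat.le_add_right _ _)
  choose X hX hmem hpq using hex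
  have hNpos : ∀ n, 0 < ∏ i ∈ Finset.range n, (N i : ℝ) := fun n =>
    Finset.prod_pos fun i _ => by exact_mod_cast hN i
  have hsub : (fun y => X y 0) '' Ico 0 1 ⊆ E := by
    rintro _ ⟨y, hy, rfl⟩
    refine hE _ (hmem y) fun i => ?_
    have := radixDigit_lt hN hy i
    rw [hpq]
    omega
  refine le_trans (le_dimH_image_of_abs_sub_le hC hs fun y hy z hz => ?_) (dimH_mono hsub)
  by_cases hall : ∀ n, radixDigit N y n = radixDigit N z n
  · have : |y - z| = 0 := by
      by_contra hne
      have hpos : 0 < |y - z| := lt_of_le_of_ne (abs_nonneg _) (Ne.symm hne)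
      obtain ⟨n, hn⟩ := ((hNtop.const_mul_atTop hpos).eventually_gt_atTop 1).exists
      exact absurd (abs_sub_mul_prod_le_one hy hz n fun i _ => hall i) (not_le.2 hn)
    rw [this]
    positivity
  · push Not at hall
    classical
    obtain ⟨n, hn, hmin⟩ : ∃ n, radixDigit N y n ≠ radixDigit N z n ∧
        ∀ i < n, radixDigit N y i = radixDigit N z i :=
      ⟨Nat.find hall, Nat.find_spec hall, fun i hi => not_not.1 (Nat.find_min hall hi)⟩
    have hAdig : ∀ {w : ℝ}, w ∈ Ico (0 : ℝ) 1 → ∀ k,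
        ((b k + radixDigit N w k : ℕ) : ℝ) + 1 ≤ A k := fun {w} hw k => by
      refine le_trans ?_ (hA k)
      have : b k + radixDigit N w k + 1 ≤ b k + N k := by
        have := radixDigit_lt hN hw k
        omega
      exact_mod_cast this
    have hsep := half_mul_prod_le_abs_sub (hX y) (hX z) (fun k => (hb k).trans (Nat.le_add_right _ _))
      (fun k => (hb k).trans (Nat.le_add_right _ _)) (hAdig hy) (hAdig hz) n 0
      (fun i hi => by simp only [zero_add, hmin i hi]) (by simpa using hn)
    simp only [zero_add] at hsep
    calc |y - z| ≤ (∏ i ∈ Finset.range n, (N i : ℝ))⁻¹ := by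
          rw [← one_div, le_div_iff₀ (hNpos n)]
          exact abs_sub_mul_prod_le_one hy hz n hmin
      _ ≤ _ := hbound n
      _ ≤ _ := by gcongr

theorem tendsto_Lmax_div {u G : ℕ → ℝ} {ℓ : ℕ → ℝ} {x : ℝ} (hu : Monotone u)
    (hdiff : Tendsto (fun n => u (n + 1) - u n) atTop (nhds 0))
    (hℓ : ∀ n, ℓ (n + 1) = Real.exp (2 * u n)) (hG : Monotone G)
    (hGlim : Tendsto (fun n => G n / Real.exp (u n)) atTop (nhds 1))
    (hlow : ∀ n, Real.exp (u n) ≤ pq x (n + 1)) (hup : ∀ n, (pq x (n + 1) : ℝ) ≤ G n) :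
    Tendsto (fun n => (Lmax x n : ℝ) / ℓ n) atTop (nhds 1) := by
  rw [← tendsto_add_atTop_iff_nat 1]
  have hG0 : ∀ n, 0 ≤ G n := fun n => (Nat.cast_nonneg _).trans (hup n)
  have hupper : Tendsto (fun n => G n / Real.exp (u n) * (G (n + 1) / Real.exp (u (n + 1))) *
      Real.exp (u (n + 1) - u n)) atTop (nhds 1) := by
    have h := (hGlim.mul (hGlim.comp (tendsto_add_atTop_nat 1))).mul
      ((Real.continuous_exp.tendsto 0).comp hdiff)
    simpa using h
  refine tendsto_of_tendsto_of_tendsto_of_le_of_le tendsto_const_nhds hupper (fun n => ?_)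
    fun n => ?_
  · change 1 ≤ (Lmax x (n + 1) : ℝ) / ℓ (n + 1)
    rw [hℓ, one_le_div (Real.exp_pos _)]
    have h1 : pq x (n + 1) * pq x (n + 2) ≤ Lmax x (n + 1) := by
      rw [Lmax_succ]
      exact le_max_left _ _
    calc Real.exp (2 * u n) ≤ Real.exp (u n) * Real.exp (u (n + 1)) := by
          rw [← Real.exp_add, Real.exp_le_exp]
          linarith [hu n.le_succ]
      _ ≤ (pq x (n + 1) : ℝ) * pq x (n + 2) :=
          mul_le_mul (hlow n) (hlow (n + 1)) (Real.exp_pos _).le (Nat.cast_nonneg _)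
      _ ≤ Lmax x (n + 1) := by exact_mod_cast h1
  · change (Lmax x (n + 1) : ℝ) / ℓ (n + 1) ≤ _
    have h1 : (Lmax x (n + 1) : ℝ) ≤ G n * G (n + 1) := by
      rw [← Nat.le_floor_iff (mul_nonneg (hG0 _) (hG0 _))]
      refine Finset.sup_le fun i hi => ?_
      rw [Finset.mem_Icc] at hi
      obtain ⟨j, rfl⟩ : ∃ j, i = j + 1 := ⟨i - 1, by omega⟩
      rw [Nat.le_floor_iff (mul_nonneg (hG0 _) (hG0 _))]
      push_cast
      exact mul_le_mul ((hup j).trans (hG (by omega))) ((hup (j + 1)).trans (hG (by omega)))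
        (Nat.cast_nonneg _) (hG0 _)
    refine (div_le_div_of_nonneg_right h1 (by rw [hℓ]; positivity)).trans_eq ?_
    rw [hℓ, two_mul, Real.exp_add, Real.exp_sub]
    have h2 := Real.exp_pos (u n)
    have h3 := Real.exp_pos (u (n + 1))
    field_simp

theorem exists_le_sum_range {v : ℕ → ℝ} (hv : ∀ᶠ n in atTop, 0 ≤ v n) :
    ∃ c, ∀ n, c ≤ ∑ i ∈ Finset.range n, v i := by
  obtain ⟨N, hN⟩ := eventually_atTop.1 hv
  refine ⟨-∑ i ∈ Finset.range N, |v i|, fun n => ?_⟩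
  have h1 : ∀ m, ∑ i ∈ Finset.range m, v i ≥ -∑ i ∈ Finset.range m, |v i| := fun m => by
    rw [← Finset.sum_neg_distrib]
    exact Finset.sum_le_sum fun i _ => neg_abs_le _
  rcases le_total n N with h | h
  · refine le_trans (neg_le_neg ?_) (h1 n)
    exact Finset.sum_le_sum_of_subset_of_nonneg (Finset.range_mono h) fun i _ _ => abs_nonneg _
  · refine (h1 N).le.trans ?_
    exact Finset.sum_le_sum_of_subset_of_nonneg (Finset.range_mono h) fun i _ hi =>
      hN i (by simpa using hi)

theorem le_dimH_Lset {u : ℕ → ℝ} {ℓ : ℕ → ℝ} (hu : Monotone u) (hutop : Tendsto u atTop atTop)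
    (hdiff : Tendsto (fun n => u (n + 1) - u n) atTop (nhds 0))
    (hℓ : ∀ n, ℓ (n + 1) = Real.exp (2 * u n)) {s : ℝ} (hs : 0 < s) (hs2 : s < 1 / 2) :
    ENNReal.ofReal s ≤ dimH (Lset ℓ) := by
  set δ := 1 / 2 - s with hδ
  have hδ0 : 0 < δ := by linarith
  have hδ1 : 0 < 1 - δ := by linarith
  have h2s : 2 * s = 1 - 2 * δ := by rw [hδ]; ring
  set N : ℕ → ℕ := fun n => ⌈Real.exp ((1 - δ) * u n)⌉₊ with hNdef
  set b : ℕ → ℕ := fun n => ⌈Real.exp (u n)⌉₊ + 1 with hbdef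
  set G : ℕ → ℝ := fun n => Real.exp (u n) + 3 + Real.exp ((1 - δ) * u n) with hGdef
  have hN1 : ∀ n, 1 ≤ N n := fun n => Nat.ceil_pos.2 (Real.exp_pos _)
  have hb2 : ∀ n, 2 ≤ b n := fun n => Nat.succ_le_succ (Nat.ceil_pos.2 (Real.exp_pos _))
  have hbN : ∀ n, (b n : ℝ) + N n ≤ G n := fun n => by
    have h1 := (Nat.ceil_lt_add_one (Real.exp_pos (u n)).le).le
    have h2 := (Nat.ceil_lt_add_one (Real.exp_pos ((1 - δ) * u n)).le).le
    simp only [hNdef, hbdef, hGdef]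
    push_cast
    linarith
  set c₀ := Real.log (1 + 3 * Real.exp (-u 0) + Real.exp (-(δ * u 0))) with hc₀
  have hA : ∀ n, (b n : ℝ) + N n ≤ Real.exp (u n + c₀) := fun n => by
    refine (hbN n).trans ?_
    rw [Real.exp_add, hc₀, Real.exp_log (by positivity), mul_add, mul_add, mul_one]
    have hu0 := hu (Nat.zero_le n)
    have h1 : 3 ≤ Real.exp (u n) * (3 * Real.exp (-u 0)) := by
      rw [mul_left_comm, ← Real.exp_add]
      have := Real.one_le_exp (x := u n + -u 0) (by linarith)
      linarith
    have h2 : Real.exp ((1 - δ) * u n) ≤ Real.exp (u n) * Real.exp (-(δ * u 0)) := by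
      rw [← Real.exp_add, Real.exp_le_exp]
      nlinarith
    simp only [hGdef]
    linarith
  obtain ⟨D, hD⟩ := hdiff.bddAbove_range
  have hD' : ∀ n, u (n + 1) - u n ≤ D := fun n => hD (mem_range_self n)
  have hulin : ∀ n : ℕ, u n ≤ u 0 + D * n := by
    intro n
    induction n with
    | zero => simp
    | succ n ih => push_cast; linarith [hD' n]
  have hprodN : ∀ n, Real.exp ((1 - δ) * ∑ i ∈ Finset.range n, u i) ≤
      ∏ i ∈ Finset.range n, (N i : ℝ) := fun n => by
    rw [Finset.mul_sum, Real.exp_sum]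
    exact Finset.prod_le_prod (fun i _ => (Real.exp_pos _).le) fun i _ => Nat.le_ceil _
  obtain ⟨c₁, hc₁⟩ := exists_le_sum_range (v := fun n => u n - 1)
    ((hutop.eventually_ge_atTop 1).mono fun n hn => sub_nonneg.2 hn)
  obtain ⟨c₂, hc₂⟩ := exists_le_sum_range (v := fun n => δ * u n - 2 * s * (D + c₀))
    (((hutop.const_mul_atTop hδ0).eventually_ge_atTop (2 * s * (D + c₀))).mono
      fun n hn => sub_nonneg.2 hn)
  have hNtop : Tendsto (fun n => ∏ i ∈ Finset.range n, (N i : ℝ)) atTop atTop := by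
    refine tendsto_atTop_mono hprodN (Real.tendsto_exp_atTop.comp ?_)
    refine Tendsto.const_mul_atTop hδ1 ?_
    refine tendsto_atTop_mono (f := fun n : ℕ => c₁ + n) (fun n => ?_)
      (tendsto_atTop_add_const_left _ _ tendsto_natCast_atTop_atTop)
    have := hc₁ n
    rw [Finset.sum_sub_distrib] at this
    simp only [Finset.sum_const, Finset.card_range, nsmul_eq_mul, mul_one] at this
    linarith
  set c₃ := 2 * s * (u 0 + c₀) - c₂ with hc₃
  refine le_dimH_of_forall_pq_mem hN1 hb2 hA
    (C := Real.exp c₃ * 2 ^ s) (by positivity) hs hNtop (fun n => ?_) ?_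
  · have e : ∏ i ∈ Finset.range (n + 1), (Real.exp (u i + c₀) ^ 2)⁻¹ =
        Real.exp (-2 * ∑ i ∈ Finset.range (n + 1), (u i + c₀)) := by
      rw [Finset.mul_sum, Real.exp_sum]
      refine Finset.prod_congr rfl fun i _ => ?_
      rw [← Real.exp_nat_mul, ← Real.exp_neg]
      push_cast
      ring_nf
    rw [e, Real.mul_rpow (by norm_num) (Real.exp_pos _).le, ← Real.exp_mul, one_div,
      Real.inv_rpow (by norm_num), mul_assoc, mul_inv_cancel_left₀ (by positivity),
      ← Real.exp_add]
    refine (inv_anti₀ (Real.exp_pos _) (hprodN n)).trans ?_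
    rw [← Real.exp_neg, Real.exp_le_exp, Finset.sum_range_succ, Finset.sum_add_distrib]
    have h1 := hc₂ n
    rw [Finset.sum_sub_distrib, ← Finset.mul_sum] at h1
    simp only [Finset.sum_const, Finset.card_range, nsmul_eq_mul] at h1 ⊢
    have h2 := mul_le_mul_of_nonneg_left (hulin n) (by linarith : 0 ≤ 2 * s)
    have h3 : (1 - δ) * ∑ i ∈ Finset.range n, u i =
        2 * s * ∑ i ∈ Finset.range n, u i + δ * ∑ i ∈ Finset.range n, u i := by
      rw [h2s]; ring
    rw [h3, hc₃]
    linarith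
  · intro x hx hpq
    refine ⟨hx.1, hx.2, tendsto_Lmax_div (G := G) hu hdiff hℓ ?_ ?_ (fun n => ?_) fun n => ?_⟩
    · intro m n hmn
      have := hu hmn
      simp only [hGdef]
      gcongr
    · have h1 : Tendsto (fun n => 3 * Real.exp (-u n)) atTop (nhds 0) := by
        simpa using (Real.tendsto_exp_neg_atTop_nhds_zero.comp hutop).const_mul 3
      have h2 : Tendsto (fun n => Real.exp (-(δ * u n))) atTop (nhds 0) :=
        Real.tendsto_exp_neg_atTop_nhds_zero.comp (hutop.const_mul_atTop hδ0)
      have h3 := (tendsto_const_nhds (x := (1 : ℝ))).add (h1.add h2)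
      rw [add_zero, add_zero] at h3
      refine h3.congr fun n => ?_
      rw [eq_div_iff (Real.exp_pos _).ne', add_mul, add_mul, one_mul, mul_assoc, ← Real.exp_add,
        ← Real.exp_add]
      simp only [hGdef]
      ring_nf
      rw [Real.exp_zero]
      ring
    · calc Real.exp (u n) ≤ ⌈Real.exp (u n)⌉₊ := Nat.le_ceil _
        _ ≤ b n := by simp [hbdef]
        _ ≤ pq x (n + 1) := by exact_mod_cast (hpq n).1
    · refine le_trans ?_ (hbN n)
      exact_mod_cast (hpq n).2.le

/-- Theorem 1.3, second case: if `R` is regularly increasing with index `0` and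
`log φ(n) = √n · R(n)`, then `dim_H L(φ) = 1/2`. -/
theorem statement4 (R φ : ℝ → ℝ)
    (hR : RegInc R 0)
    (hφpos : ∀ x > (0 : ℝ), 0 < φ x)
    (hφmono : MonotoneOn φ (Ioi (0 : ℝ)))
    (hlog : ∀ n : ℕ, 1 ≤ n → Real.log (φ n) = Real.sqrt n * R n) :
    dimH (Lset fun n : ℕ => φ n) = 1 / 2 := by
  have hpos : ∀ n : ℕ, 1 ≤ n → 0 < φ n := fun n hn => hφpos n (by exact_mod_cast hn)
  have hdiff : Tendsto (fun n : ℕ => Real.log (φ (n + 1 : ℕ)) - Real.log (φ n))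
      atTop (nhds 0) := by
    refine hR.tendsto_sqrt_mul_sub.congr' ?_
    filter_upwards [eventually_ge_atTop 1] with n hn
    rw [hlog n hn, hlog (n + 1) (by omega)]
  have hRtop : Tendsto (fun n : ℕ => R n) atTop atTop := by
    obtain ⟨c, -, f', -, -, -, -, h, -⟩ := hR
    exact h.comp tendsto_natCast_atTop_atTop
  have hsqrt : Tendsto (fun n : ℕ => Real.log (φ n) / √n) atTop atTop := by
    refine hRtop.congr' ?_
    filter_upwards [eventually_ge_atTop 1] with n hn
    rw [hlog n hn, mul_div_cancel_left₀]
    exact (Real.sqrt_pos.2 (by exact_mod_cast hn)).ne'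
  apply le_antisymm
  · exact dimH_le_half_of_pow_le_prod_pq (fun x hx => ⟨hx.1, hx.2.1⟩) fun x hx =>
      pow_le_prod_pq_of_mem_Lset ((eventually_ge_atTop 1).mono hpos) hdiff hsqrt hx
  · set u : ℕ → ℝ := fun n => Real.log (φ (n + 1 : ℕ)) / 2 with hudef
    have hu : Monotone u := monotone_nat_of_le_succ fun n => by
      refine div_le_div_of_nonneg_right (Real.log_le_log (hpos _ (by omega)) ?_) (by norm_num)
      refine hφmono ?_ ?_ ?_
      · exact mem_Ioi.2 (by positivity)
      · exact mem_Ioi.2 (by positivity)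
      · exact_mod_cast Nat.le_succ _
    have hlogtop : Tendsto (fun n : ℕ => Real.log (φ n)) atTop atTop := by
      refine tendsto_atTop_mono' _ ?_ hRtop
      filter_upwards [eventually_ge_atTop 1, hRtop.eventually_ge_atTop 0] with n hn hRn
      rw [hlog n hn]
      have : 1 ≤ √(n : ℝ) := Real.one_le_sqrt.2 (by exact_mod_cast hn)
      nlinarith
    have hutop : Tendsto u atTop atTop :=
      (hlogtop.comp (tendsto_add_atTop_nat 1)).atTop_div_const (by norm_num)
    have hudiff : Tendsto (fun n => u (n + 1) - u n) atTop (nhds 0) := by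
      have := (hdiff.comp (tendsto_add_atTop_nat 1)).div_const 2
      rw [zero_div] at this
      refine this.congr fun n => ?_
      simp only [hudef, Function.comp]
      ring
    have hℓ : ∀ n : ℕ, φ ((n + 1 : ℕ) : ℝ) = Real.exp (2 * u n) := fun n => by
      rw [hudef, mul_div_cancel₀ _ two_ne_zero, Real.exp_log (hpos _ (by omega))]
    have key : ∀ s : ℝ, 0 < s → s < 1 / 2 →
        ENNReal.ofReal s ≤ dimH (Lset fun n : ℕ => φ n) := fun s hs hs2 =>
      le_dimH_Lset hu hutop hudiff hℓ hs hs2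
    have hhalf : (1 / 2 : ℝ≥0∞) = ENNReal.ofReal (1 / 2) := by
      rw [ENNReal.ofReal_div_of_pos (by norm_num)]
      simp
    rw [hhalf]
    refine le_of_tendsto (x := nhdsWithin (1 / 2 : ℝ) (Iio (1 / 2)))
      (f := fun s => ENNReal.ofReal s) ?_ ?_
    · exact (ENNReal.tendsto_ofReal tendsto_id).mono_left nhdsWithin_le_nhds
    · filter_upwards [Ioo_mem_nhdsLT (show (0 : ℝ) < 1 / 2 by norm_num)] with s hs
      exact key s hs.1 hs.2
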